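/- Fix λ > 0, 0 < β < 1, x ≥ 0, and let R_n^{(β)} be the exponential-preserving Szász-Mirakyan-Jain operator. Then lim_{n→∞} n·R_n^{(β)}(t ↦ (t-x)²; x) = x/(1-β)². -/

import Mathlib

open Real

/-- The Szász-Mirakyan-Jain operator with parameter `a`. -/
noncomputable def SMJ (β : ℝ) (n : ℕ) (a : ℝ) (f : ℝ → ℝ) : ℝ :=
  n * a * ∑' k : ℕ,
    (n * a + β * k) ^ ((k : ℝ) - 1) / (Nat.factorial k : ℝ) *
      Real.exp (-(n * a + β * k)) * f (k / n)
open Filter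

theorem summable_mul_pow_of_abs_le {c : ℕ → ℝ} {C R u : ℝ} {m : ℕ}
    (hR : 0 ≤ R) (hc : ∀ k, |c k| ≤ C * (k : ℝ) ^ m * R ^ k) (hu : R * |u| < 1) :
    Summable fun k : ℕ => c k * u ^ k := by
  have hgeom : Summable fun k : ℕ => (k : ℝ) ^ m * (R * |u|) ^ k :=
    summable_pow_mul_geometric_of_norm_lt_one m (by
      rwa [Real.norm_of_nonneg (by positivity)])
  refine Summable.of_norm_bounded (hgeom.mul_left C) fun k => ?_
  rw [Real.norm_eq_abs, abs_mul, abs_pow]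
  calc |c k| * |u| ^ k ≤ C * (k : ℝ) ^ m * R ^ k * |u| ^ k := by gcongr; exact hc k
    _ = C * ((k : ℝ) ^ m * (R * |u|) ^ k) := by rw [mul_pow]; ring

theorem hasDerivAt_tsum_mul_pow {c : ℕ → ℝ} {C R u : ℝ} {m : ℕ}
    (hR : 0 < R) (hc : ∀ k, |c k| ≤ C * (k : ℝ) ^ m * R ^ k) (hu : R * |u| < 1) :
    HasDerivAt (fun v => ∑' k : ℕ, c k * v ^ k)
      (∑' k : ℕ, c k * (k * u ^ (k - 1))) u := by
  obtain ⟨r, hur, hr⟩ := exists_between ((lt_div_iff₀' hR).2 hu)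
  have hr0 : 0 < r := (abs_nonneg u).trans_lt hur
  have hr1 : R * r < 1 := (lt_div_iff₀' hR).1 hr
  have hnorm : ‖R * r‖ < 1 := by rwa [Real.norm_of_nonneg (by positivity)]
  have hgeom : Summable fun k : ℕ => (k : ℝ) ^ (m + 1) * (R * r) ^ k :=
    summable_pow_mul_geometric_of_norm_lt_one (m + 1) hnorm
  have hbound : ∀ (k : ℕ) (y : ℝ), y ∈ Set.Ioo (-r) r →
      ‖c k * (k * y ^ (k - 1))‖ ≤ C / r * ((k : ℝ) ^ (m + 1) * (R * r) ^ k) := fun k y hy => by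
    have hy' : |y| ≤ r := (abs_lt.2 hy).le
    rw [Real.norm_eq_abs, abs_mul, abs_mul, abs_pow, Nat.abs_cast]
    rcases k with _ | k
    · simp
    · rw [Nat.add_sub_cancel]
      calc |c (k + 1)| * (((k + 1 : ℕ) : ℝ) * |y| ^ k)
          ≤ C * ((k + 1 : ℕ) : ℝ) ^ m * R ^ (k + 1) * (((k + 1 : ℕ) : ℝ) * r ^ k) := by
            gcongr
            · exact (abs_nonneg _).trans (hc _)
            · exact hc _
        _ = C / r * (((k + 1 : ℕ) : ℝ) ^ (m + 1) * (R * r) ^ (k + 1)) := by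
            rw [mul_pow, pow_succ r k]
            field_simp
            ring
  have hderiv : ∀ (k : ℕ) (y : ℝ), y ∈ Set.Ioo (-r) r →
      HasDerivAt (fun v : ℝ => c k * v ^ k) (c k * (k * y ^ (k - 1))) y := fun k y _ =>
    (hasDerivAt_pow k y).const_mul (c k)
  have hmem : u ∈ Set.Ioo (-r) r := abs_lt.1 hur
  exact hasDerivAt_tsum_of_isPreconnected (hgeom.mul_left (C / r)) isOpen_Ioo isPreconnected_Ioo
    hderiv hbound hmem (summable_mul_pow_of_abs_le hR.le hc hu) hmem

theorem analyticAt_tsum_mul_pow {c : ℕ → ℝ} {C R u : ℝ}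
    (hR : 0 < R) (hc : ∀ k, |c k| ≤ C * R ^ k) (hu : R * |u| < 1) :
    AnalyticAt ℝ (fun v => ∑' k : ℕ, c k * v ^ k) u := by
  set p := FormalMultilinearSeries.ofScalars ℝ c with hp
  have hrad : ((Real.toNNReal R⁻¹ : NNReal) : ENNReal) ≤ p.radius := by
    refine p.le_radius_of_bound C fun k => ?_
    have h1 : ‖p k‖ = |c k| := by
      rw [hp, FormalMultilinearSeries.ofScalars_norm, Real.norm_eq_abs]
    rw [h1, Real.coe_toNNReal _ (inv_nonneg.2 hR.le)]
    calc |c k| * R⁻¹ ^ k ≤ C * R ^ k * R⁻¹ ^ k := by gcongr; exact hc k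
      _ = C := by rw [mul_assoc, ← mul_pow, mul_inv_cancel₀ hR.ne', one_pow, mul_one]
  have hpos : 0 < p.radius := lt_of_lt_of_le (by simpa using hR) hrad
  have hmem : u ∈ Metric.eball (0 : ℝ) p.radius := by
    rw [Metric.mem_eball, edist_zero_right]
    refine lt_of_lt_of_le ?_ hrad
    rw [enorm_eq_nnnorm, ENNReal.coe_lt_coe, ← NNReal.coe_lt_coe, coe_nnnorm, Real.norm_eq_abs,
      Real.coe_toNNReal _ (inv_nonneg.2 hR.le)]
    rwa [← one_div, lt_div_iff₀' hR]
  have hsum : p.sum = fun v => ∑' k : ℕ, c k * v ^ k := by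
    funext v
    simp [FormalMultilinearSeries.sum, hp, mul_comm]
  rw [← hsum]
  exact (p.hasFPowerSeriesOnBall hpos).analyticAt_of_mem hmem

/-- The coefficients of the power series of `exp (s * b)` in the variable `b * exp (-b)`. -/
noncomputable def abelCoeff (s : ℝ) (k : ℕ) : ℝ := s / (s + k) * ((s + k) ^ k / k.factorial)

theorem abelCoeff_nonneg {s : ℝ} (hs : 0 < s) (k : ℕ) : 0 ≤ abelCoeff s k := by
  unfold abelCoeff; positivity

theorem abelCoeff_le {s : ℝ} (hs : 0 < s) (k : ℕ) :
    abelCoeff s k ≤ Real.exp s * Real.exp 1 ^ k := by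
  have h1 : s / (s + k) ≤ 1 := div_le_one_of_le₀ (by simp) (by positivity)
  have h2 := Real.pow_div_factorial_le_exp (x := s + k) (by positivity) k
  calc abelCoeff s k ≤ 1 * Real.exp (s + k) := by unfold abelCoeff; gcongr
    _ = _ := by rw [one_mul, Real.exp_add, ← Real.exp_nat_mul, mul_one]

theorem exp_one_mul_abs_lt_one {b : ℝ} (hb0 : 0 < b) (hb1 : b < 1) :
    Real.exp 1 * |b * Real.exp (-b)| < 1 := by
  rw [abs_of_pos (by positivity), mul_left_comm, ← Real.exp_add]
  have h := Real.add_one_lt_exp (x := b - 1) (by linarith)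
  calc b * Real.exp (1 + -b) < Real.exp (b - 1) * Real.exp (1 + -b) := by
        gcongr; linarith
    _ = 1 := by rw [← Real.exp_add, Real.exp_eq_one_iff]; ring

theorem sum_antidiagonal_abelCoeff {s : ℝ} (hs : 0 < s) (b : ℝ) (n : ℕ) :
    ∑ p ∈ Finset.HasAntidiagonal.antidiagonal n,
      abelCoeff s p.1 * b ^ p.1 * ((-((s + p.1) * b)) ^ p.2 / p.2.factorial) =
      if n = 0 then 1 else 0 := by
  rcases n with _ | n
  · simp [abelCoeff, hs.ne']
  · have h := congrFun (fwdDiff_iter_pow_eq_zero_of_lt (R := ℝ) (Nat.lt_succ_self n)) s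
    rw [fwdDiff_iter_eq_sum_shift] at h
    rw [Finset.Nat.sum_antidiagonal_eq_sum_range_succ_mk, if_neg (Nat.succ_ne_zero n)]
    calc _ = ∑ k ∈ Finset.range (n + 1 + 1), s * b ^ (n + 1) / (n + 1).factorial *
          (((-1 : ℤ) ^ (n + 1 - k) * (n + 1).choose k) • (s + k • (1 : ℝ)) ^ n) := by
          refine Finset.sum_congr rfl fun k hk => ?_
          have hkn : k ≤ n + 1 := Nat.lt_succ_iff.1 (Finset.mem_range.1 hk)
          obtain ⟨j, hj⟩ := Nat.exists_eq_add_of_le hkn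
          have hjk : n + 1 - k = j := by omega
          have hfac : ((n + 1).choose k : ℝ) * (k.factorial * j.factorial) =
              (n + 1).factorial := by
            have := Nat.choose_mul_factorial_mul_factorial hkn
            rw [hjk] at this
            rw [← mul_assoc]
            exact_mod_cast this
          have hsk : s + k ≠ 0 := by positivity
          have hpow : (s + k) ^ k * (s + k) ^ j = (s + k) ^ n * (s + k) := by
            rw [← pow_add, ← hj, pow_succ]
          have hb : b ^ (n + 1) = b ^ k * b ^ j := by rw [hj, pow_add]
          have hk0 : (k.factorial : ℝ) ≠ 0 := by positivity
          have hj0 : (j.factorial : ℝ) ≠ 0 := by positivity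
          have hc0 : ((n + 1).choose k : ℝ) ≠ 0 :=
            Nat.cast_ne_zero.2 (Nat.choose_pos hkn).ne'
          simp only [hjk, abelCoeff, zsmul_eq_mul, nsmul_eq_mul, mul_one]
          push_cast
          rw [← hfac, hb, neg_eq_neg_one_mul ((s + k) * b), mul_pow, mul_pow]
          field_simp
          linear_combination b ^ k * b ^ j * hpow
      _ = 0 := by rw [← Finset.mul_sum]; simp only [Nat.succ_eq_add_one] at h; rw [h]; simp

theorem tsum_abelCoeff_of_small {s b : ℝ} (hs : 0 < s) (hb0 : 0 < b) (hb : b < 1 / 8) :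
    ∑' k : ℕ, abelCoeff s k * (b * Real.exp (-b)) ^ k = Real.exp (s * b) := by
  set f : ℕ × ℕ → ℝ := fun p =>
    abelCoeff s p.1 * b ^ p.1 * ((-((s + p.1) * b)) ^ p.2 / p.2.factorial) with hf
  have hexp : ∀ y : ℝ, HasSum (fun j : ℕ => y ^ j / j.factorial) (Real.exp y) := fun y => by
    rw [Real.exp_eq_exp_ℝ]
    exact NormedSpace.expSeries_div_hasSum_exp y
  have hrow : ∀ k, HasSum (fun j => f (k, j))
      (abelCoeff s k * b ^ k * Real.exp (-((s + k) * b))) := fun k => (hexp _).mul_left _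
  have hnorm : ∀ k j, ‖f (k, j)‖ =
      abelCoeff s k * b ^ k * (((s + k) * b) ^ j / j.factorial) := fun k j => by
    have h1 := abelCoeff_nonneg hs k
    rw [hf, Real.norm_eq_abs, abs_mul, abs_div, abs_pow, abs_neg, abs_of_nonneg (by positivity),
      abs_of_nonneg (a := (s + k) * b) (by positivity), Nat.abs_cast]
  have hrownorm : ∀ k, HasSum (fun j => ‖f (k, j)‖)
      (abelCoeff s k * b ^ k * Real.exp ((s + k) * b)) := fun k => by
    simp only [hnorm]
    exact (hexp _).mul_left _
  have hsmall : Real.exp 1 * |b * Real.exp b| < 1 := by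
    rw [abs_of_pos (by positivity)]
    have h1 : Real.exp 1 < 3 := Real.exp_one_lt_d9.trans (by norm_num)
    have h2 : Real.exp b < 2 := by
      have hlog : b < Real.log 2 := by linarith [Real.log_two_gt_d9]
      calc Real.exp b < Real.exp (Real.log 2) := Real.exp_lt_exp.2 hlog
        _ = 2 := Real.exp_log (by norm_num)
    calc Real.exp 1 * (b * Real.exp b) ≤ 3 * (1 / 8 * 2) := by gcongr
      _ < 1 := by norm_num
  have hsummable : Summable f := by
    refine Summable.of_norm ((summable_prod_of_nonneg fun _ => norm_nonneg _).2
      ⟨fun k => (hrownorm k).summable, ?_⟩)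
    simp only [(hrownorm _).tsum_eq]
    have hgeom := summable_mul_pow_of_abs_le (c := abelCoeff s) (C := Real.exp s) (m := 0)
      (Real.exp_pos 1).le (fun k => by
        rw [abs_of_nonneg (abelCoeff_nonneg hs k), pow_zero, mul_one]
        exact abelCoeff_le hs k) hsmall
    refine (hgeom.mul_left (Real.exp (s * b))).congr fun k => ?_
    rw [mul_pow, ← Real.exp_nat_mul, add_mul, Real.exp_add]
    ring
  have hdiag : HasSum f 1 := by
    have h1 := Finset.HasAntidiagonal.sigmaAntidiagonalEquivProd.hasSum_iff.2 hsummable.hasSum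
    have h2 := h1.sigma fun n => hasSum_fintype _
    have h3 : (fun n : ℕ => ∑ p : Finset.HasAntidiagonal.antidiagonal n,
        (f ∘ Finset.HasAntidiagonal.sigmaAntidiagonalEquivProd) ⟨n, p⟩) =
        fun n => if n = 0 then 1 else 0 := by
      funext n
      rw [← sum_antidiagonal_abelCoeff hs b n]
      exact Finset.sum_coe_sort (Finset.HasAntidiagonal.antidiagonal n) f
    rw [h3] at h2
    rw [← h2.unique (hasSum_ite_eq 0 1)]
    exact hsummable.hasSum
  have hrows := (hdiag.prod_fiberwise hrow).mul_left (Real.exp (s * b))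
  rw [mul_one] at hrows
  rw [← hrows.tsum_eq]
  refine tsum_congr fun k => ?_
  rw [mul_pow, ← Real.exp_nat_mul, neg_eq_neg_one_mul ((s + k) * b),
    show (-1 : ℝ) * ((s + k) * b) = -(s * b) + k * -b by ring, Real.exp_add, Real.exp_neg (s * b)]
  field_simp

theorem tsum_abelCoeff {s b : ℝ} (hs : 0 < s) (hb0 : 0 < b) (hb1 : b < 1) :
    ∑' k : ℕ, abelCoeff s k * (b * Real.exp (-b)) ^ k = Real.exp (s * b) := by
  have hF : AnalyticOnNhd ℝ (fun b => ∑' k : ℕ, abelCoeff s k * (b * Real.exp (-b)) ^ k)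
      (Set.Ioo 0 1) := fun y hy =>
    (analyticAt_tsum_mul_pow (c := abelCoeff s) (C := Real.exp s) (Real.exp_pos 1)
      (fun k => by
        rw [abs_of_nonneg (abelCoeff_nonneg hs k)]
        exact abelCoeff_le hs k) (exp_one_mul_abs_lt_one hy.1 hy.2)).fun_comp
      (f := fun y : ℝ => y * Real.exp (-y)) (by fun_prop)
  have hG : AnalyticOnNhd ℝ (fun b => Real.exp (s * b)) (Set.Ioo 0 1) := fun y _ => by fun_prop
  refine hF.eqOn_of_preconnected_of_eventuallyEq hG isPreconnected_Ioo (z₀ := 1 / 16)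
    (by constructor <;> norm_num) ?_ ⟨hb0, hb1⟩
  filter_upwards [Ioo_mem_nhds (show (0 : ℝ) < 1 / 16 by norm_num)
    (show (1 / 16 : ℝ) < 1 / 8 by norm_num)] with y hy
  exact tsum_abelCoeff_of_small hs hy.1 hy.2

theorem abs_pow_mul_abelCoeff_le {s : ℝ} (hs : 0 < s) (m k : ℕ) :
    |(k : ℝ) ^ m * abelCoeff s k| ≤ Real.exp s * (k : ℝ) ^ m * Real.exp 1 ^ k := by
  rw [abs_of_nonneg (mul_nonneg (by positivity) (abelCoeff_nonneg hs k)), mul_right_comm,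
    mul_comm]
  gcongr
  exact abelCoeff_le hs k

theorem summable_pow_mul_abelCoeff {s b : ℝ} (hs : 0 < s) (hb0 : 0 < b) (hb1 : b < 1) (m : ℕ) :
    Summable fun k : ℕ => (k : ℝ) ^ m * abelCoeff s k * (b * Real.exp (-b)) ^ k :=
  summable_mul_pow_of_abs_le (Real.exp_pos 1).le (abs_pow_mul_abelCoeff_le hs m)
    (exp_one_mul_abs_lt_one hb0 hb1)

/-- The operator `u * d/du` raises the power of `k`; in the variable `b` with
`u = b * exp (-b)` it is `b / (1 - b) * d/db`. -/
theorem tsum_pow_succ_mul_abelCoeff {s : ℝ} (hs : 0 < s) {m : ℕ} {g : ℝ → ℝ}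
    (hg : ∀ b, 0 < b → b < 1 →
      ∑' k : ℕ, (k : ℝ) ^ m * abelCoeff s k * (b * Real.exp (-b)) ^ k = g b)
    {b g' : ℝ} (hb0 : 0 < b) (hb1 : b < 1) (hd : HasDerivAt g g' b) :
    ∑' k : ℕ, (k : ℝ) ^ (m + 1) * abelCoeff s k * (b * Real.exp (-b)) ^ k =
      b / (1 - b) * g' := by
  have hF := hasDerivAt_tsum_mul_pow (Real.exp_pos 1) (abs_pow_mul_abelCoeff_le hs m)
    (exp_one_mul_abs_lt_one hb0 hb1)
  have hu : HasDerivAt (fun b : ℝ => b * Real.exp (-b)) ((1 - b) * Real.exp (-b)) b := by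
    have h := (hasDerivAt_id b).mul (hasDerivAt_neg b).exp
    convert! h using 1
    simp only [id]
    ring
  have hcomp := hF.comp b hu
  have heq : ((fun v => ∑' k : ℕ, (k : ℝ) ^ m * abelCoeff s k * v ^ k) ∘
      fun b : ℝ => b * Real.exp (-b)) =ᶠ[nhds b] g := by
    filter_upwards [Ioo_mem_nhds hb0 hb1] with y hy using hg y hy.1 hy.2
  have hval := (hd.congr_of_eventuallyEq heq).unique hcomp
  rw [hval]
  have h1b : 1 - b ≠ 0 := by linarith
  calc _ = (b * Real.exp (-b)) * ∑' k : ℕ, (k : ℝ) ^ m * abelCoeff s k *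
        (k * (b * Real.exp (-b)) ^ (k - 1)) := by
        rw [← tsum_mul_left]
        refine tsum_congr fun k => ?_
        rcases k with _ | k
        · simp
        · rw [Nat.add_sub_cancel, pow_succ (b * Real.exp (-b))]
          ring
    _ = _ := by field_simp

theorem tsum_mul_abelCoeff {s b : ℝ} (hs : 0 < s) (hb0 : 0 < b) (hb1 : b < 1) :
    ∑' k : ℕ, (k : ℝ) ^ 1 * abelCoeff s k * (b * Real.exp (-b)) ^ k =
      b / (1 - b) * (Real.exp (s * b) * s) :=
  tsum_pow_succ_mul_abelCoeff hs (m := 0) (g := fun b => Real.exp (s * b))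
    (fun b h0 h1 => by simpa using tsum_abelCoeff hs h0 h1) hb0 hb1
    (by simpa using ((hasDerivAt_id b).const_mul s).exp)

theorem tsum_sq_mul_abelCoeff {s b : ℝ} (hs : 0 < s) (hb0 : 0 < b) (hb1 : b < 1) :
    ∑' k : ℕ, (k : ℝ) ^ 2 * abelCoeff s k * (b * Real.exp (-b)) ^ k =
      b / (1 - b) * (1 / (1 - b) ^ 2 * (Real.exp (s * b) * s) +
        b / (1 - b) * (Real.exp (s * b) * s * s)) := by
  have h1b : 1 - b ≠ 0 := by linarith
  refine tsum_pow_succ_mul_abelCoeff hs (m := 1)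
    (fun b h0 h1 => tsum_mul_abelCoeff hs h0 h1) hb0 hb1 ?_
  have h1 : HasDerivAt (fun b : ℝ => b / (1 - b)) (1 / (1 - b) ^ 2) b := by
    convert! (hasDerivAt_id b).div ((hasDerivAt_id b).const_sub 1) h1b using 1
    simp
  have h2 : HasDerivAt (fun b : ℝ => Real.exp (s * b) * s) (Real.exp (s * b) * s * s) b := by
    simpa using (((hasDerivAt_id b).const_mul s).exp).mul_const s
  exact h1.mul h2

/-- The second central moment of the Szász-Mirakyan-Jain operator. -/
theorem SMJ_sq_sub {β a x : ℝ} {n : ℕ} (hβ0 : 0 < β) (hβ1 : β < 1) (hn : 0 < n) (ha : 0 < a) :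
    SMJ β n a (fun t => (t - x) ^ 2) =
      (a / (1 - β) - x) ^ 2 + a / (n * (1 - β) ^ 3) := by
  have hn' : (0 : ℝ) < n := Nat.cast_pos.2 hn
  have h1β : 1 - β ≠ 0 := by linarith
  set s := n * a / β with hs
  have hs0 : 0 < s := by positivity
  have hsβ : n * a = s * β := by rw [hs]; field_simp
  set u := β * Real.exp (-β) with hu
  have hterm : ∀ k : ℕ, (n * a) * ((n * a + β * k) ^ ((k : ℝ) - 1) / (Nat.factorial k : ℝ) *
      Real.exp (-(n * a + β * k)) * ((k / n : ℝ) - x) ^ 2) =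
      Real.exp (-(s * β)) * (1 / n ^ 2 * ((k : ℝ) ^ 2 * abelCoeff s k * u ^ k) -
        2 * x / n * ((k : ℝ) ^ 1 * abelCoeff s k * u ^ k) +
        x ^ 2 * ((k : ℝ) ^ 0 * abelCoeff s k * u ^ k)) := fun k => by
    have hsk : 0 < s + k := by positivity
    rw [hsβ, show s * β + β * k = β * (s + k) by ring, Real.rpow_sub_one (by positivity),
      Real.rpow_natCast, show -(β * (s + k)) = -(s * β) + k * -β by ring, Real.exp_add,
      Real.exp_nat_mul, hu, mul_pow, mul_pow, abelCoeff]
    field_simp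
    ring
  have hm := summable_pow_mul_abelCoeff hs0 hβ0 hβ1
  rw [SMJ, ← tsum_mul_left]
  simp only [hterm]
  rw [tsum_mul_left, (((hm 2).mul_left _).sub ((hm 1).mul_left _)).tsum_add ((hm 0).mul_left _),
    ((hm 2).mul_left _).tsum_sub ((hm 1).mul_left _), tsum_mul_left, tsum_mul_left, tsum_mul_left,
    tsum_sq_mul_abelCoeff hs0 hβ0 hβ1, tsum_mul_abelCoeff hs0 hβ0 hβ1]
  simp only [pow_zero, one_mul]
  rw [tsum_abelCoeff hs0 hβ0 hβ1, Real.exp_neg]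
  have ha' : a = s * β / n := by rw [← hsβ]; field_simp
  rw [ha']
  field_simp
  ring

/-- Bounds on the solution `v ≤ 1` of `v * exp (-v) = β * exp (-β - t)`. -/
theorem mul_exp_neg_solution_bounds {β t v : ℝ} (hβ0 : 0 < β) (ht : 0 < t)
    (hv1 : v ≤ 1) (hv : v * Real.exp (-v) = β * Real.exp (-β - t)) :
    0 < v ∧ v < β ∧ (β - v) * (1 - β) ≤ β * t ∧ v * t ≤ (β - v) * (1 - v) := by
  have hv0 : 0 < v := by
    have h : 0 < v * Real.exp (-v) := by rw [hv]; positivity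
    exact pos_of_mul_pos_left h (Real.exp_pos _).le
  have hlog : Real.log v - v = Real.log β - β - t := by
    have h := congrArg Real.log hv
    rw [Real.log_mul hv0.ne' (Real.exp_pos _).ne', Real.log_mul hβ0.ne' (Real.exp_pos _).ne',
      Real.log_exp, Real.log_exp] at h
    linarith
  have h1 : β * (Real.log v - Real.log β) ≤ v - β := by
    have h := Real.log_le_sub_one_of_pos (div_pos hv0 hβ0)
    rw [Real.log_div hv0.ne' hβ0.ne'] at h
    calc β * (Real.log v - Real.log β) ≤ β * (v / β - 1) := by gcongr
      _ = v - β := by field_simp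
  have h2 : v * (Real.log β - Real.log v) ≤ β - v := by
    have h := Real.log_le_sub_one_of_pos (div_pos hβ0 hv0)
    rw [Real.log_div hβ0.ne' hv0.ne'] at h
    calc v * (Real.log β - Real.log v) ≤ v * (β / v - 1) := by gcongr
      _ = β - v := by field_simp
  have hdiff : Real.log β - Real.log v = t + (β - v) := by linarith
  have hdiff' : Real.log v - Real.log β = -(t + (β - v)) := by linarith
  rw [hdiff'] at h1
  rw [hdiff] at h2
  refine ⟨hv0, ?_, by linarith, by linarith⟩
  by_contra! hle
  nlinarith [mul_pos hv0 ht, mul_nonneg (sub_nonneg.2 hle) (sub_nonneg.2 hv1)]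

theorem div_one_sub_bounds {β t v x : ℝ} (hβ0 : 0 < β) (hβ1 : β < 1) (ht : 0 < t) (hx : 0 ≤ x)
    (hv1 : v ≤ 1) (hv : v * Real.exp (-v) = β * Real.exp (-β - t)) (htβ : 2 * t ≤ 1 - β) :
    0 ≤ x * t / (1 - v / β) / (1 - β) - x ∧
      x * t / (1 - v / β) / (1 - β) - x ≤ 2 * x / (1 - β) ^ 2 * t := by
  obtain ⟨hv0, hvβ, hlo, hup⟩ := mul_exp_neg_solution_bounds hβ0 ht hv1 hv
  have h1β : 0 < 1 - β := by linarith
  have hd : 0 < β - v := by linarith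
  have hβv : β ≤ 2 * v := by
    have h : (β - v) * (1 - β) ≤ β / 2 * (1 - β) := by nlinarith
    linarith [le_of_mul_le_mul_right h h1β]
  have heq : x * t / (1 - v / β) / (1 - β) - x =
      x * ((β * t - (β - v) * (1 - β)) / ((β - v) * (1 - β))) := by
    rw [one_sub_div hβ0.ne']
    field_simp
  rw [heq]
  refine ⟨mul_nonneg hx (div_nonneg (by linarith) (by positivity)), ?_⟩
  have hmain : (β * t - (β - v) * (1 - β)) / ((β - v) * (1 - β)) ≤ 2 / (1 - β) ^ 2 * t := by
    rw [div_le_iff₀ (by positivity)]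
    have hrhs : 2 / (1 - β) ^ 2 * t * ((β - v) * (1 - β)) = 2 * t * (β - v) / (1 - β) := by
      field_simp
    rw [hrhs, le_div_iff₀ h1β]
    have hkey : v * (β * t - (β - v) * (1 - β)) ≤ (β - v) ^ 2 := by nlinarith
    have hkey2 : v * ((β * t - (β - v) * (1 - β)) * (1 - β)) ≤ v * (2 * t * (β - v)) := by
      calc v * ((β * t - (β - v) * (1 - β)) * (1 - β))
          = v * (β * t - (β - v) * (1 - β)) * (1 - β) := by ring
        _ ≤ (β - v) ^ 2 * (1 - β) := by gcongr
        _ = (β - v) * ((β - v) * (1 - β)) := by ring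
        _ ≤ (β - v) * (β * t) := by gcongr
        _ ≤ (β - v) * (2 * v * t) := by gcongr
        _ = v * (2 * t * (β - v)) := by ring
    exact le_of_mul_le_mul_left hkey2 hv0
  calc x * ((β * t - (β - v) * (1 - β)) / ((β - v) * (1 - β)))
      ≤ x * (2 / (1 - β) ^ 2 * t) := by gcongr
    _ = 2 * x / (1 - β) ^ 2 * t := by ring

/-- `lim_{n→∞} n · R_n^{(β)}(t ↦ (t-x)²; x) = x/(1-β)²`. -/
theorem SMJ_second_central_moment_limit (W : ℝ → ℝ)
    (hW : ∀ y, -Real.exp (-1) ≤ y → W y * Real.exp (W y) = y ∧ -1 ≤ W y)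
    (β lam x : ℝ) (hβ0 : 0 < β) (hβ1 : β < 1) (hlam : 0 < lam) (hx : 0 ≤ x) :
    Tendsto
      (fun n : ℕ => (n : ℝ) *
        SMJ β n
          (-lam * x / (n * (-(1 / β) * W (-β * Real.exp (-β - lam / n)) - 1)))
          (fun t => (t - x) ^ 2))
      atTop (nhds (x / (1 - β) ^ 2)) := by
  rcases hx.eq_or_lt with rfl | hx0
  · simp [SMJ]
  have h1β : 0 < 1 - β := by linarith
  set a : ℕ → ℝ := fun n =>
    -lam * x / (n * (-(1 / β) * W (-β * Real.exp (-β - lam / n)) - 1)) with ha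
  set E : ℕ → ℝ := fun n => a n / (1 - β) - x with hE
  have ht : Tendsto (fun n : ℕ => lam / (n : ℝ)) atTop (nhds 0) :=
    tendsto_const_div_atTop_nhds_zero_nat lam
  have hbound : ∀ᶠ n : ℕ in atTop, 0 ≤ E n ∧ E n ≤ 2 * x / (1 - β) ^ 2 * (lam / n) := by
    filter_upwards [eventually_gt_atTop 0,
      ht.eventually_le_const (show (0 : ℝ) < (1 - β) / 2 by positivity)] with n hn htn
    have hn' : (0 : ℝ) < n := Nat.cast_pos.2 hn
    have htpos : 0 < lam / n := by positivity
    have hdom : -Real.exp (-1) ≤ -β * Real.exp (-β - lam / n) := by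
      rw [neg_mul, neg_le_neg_iff]
      calc β * Real.exp (-β - lam / n) ≤ Real.exp (β - 1) * Real.exp (-β) := by
            gcongr
            · linarith [Real.add_one_le_exp (β - 1)]
            · linarith
        _ = Real.exp (-1) := by rw [← Real.exp_add]; ring_nf
    obtain ⟨hw, hw1⟩ := hW _ hdom
    set w := W (-β * Real.exp (-β - lam / n)) with hwdef
    have hEn : E n = x * (lam / n) / (1 - -w / β) / (1 - β) - x := by
      simp only [hE, ha, ← hwdef]
      rw [show -(1 / β) * w - 1 = -(1 - -w / β) by ring, mul_neg, neg_mul, neg_div_neg_eq,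
        ← div_div, mul_comm x, div_mul_eq_mul_div]
    rw [hEn]
    exact div_one_sub_bounds hβ0 hβ1 htpos hx (by linarith)
      (by rw [neg_neg]; linarith) (by linarith)
  have hE0 : Tendsto E atTop (nhds 0) :=
    tendsto_of_tendsto_of_tendsto_of_le_of_le' tendsto_const_nhds
      (by simpa using ht.const_mul (2 * x / (1 - β) ^ 2))
      (hbound.mono fun _ h => h.1) (hbound.mono fun _ h => h.2)
  have hnE : Tendsto (fun n : ℕ => (n : ℝ) * E n ^ 2) atTop (nhds 0) := by
    refine tendsto_of_tendsto_of_tendsto_of_le_of_le' tendsto_const_nhds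
      (by simpa using hE0.const_mul (2 * x / (1 - β) ^ 2 * lam))
      (Eventually.of_forall fun n => by positivity) ?_
    filter_upwards [hbound, eventually_gt_atTop 0] with n hb hn
    have hn' : (0 : ℝ) < n := Nat.cast_pos.2 hn
    calc (n : ℝ) * E n ^ 2 = n * E n * E n := by ring
      _ ≤ n * (2 * x / (1 - β) ^ 2 * (lam / n)) * E n :=
          mul_le_mul_of_nonneg_right (mul_le_mul_of_nonneg_left hb.2 hn'.le) hb.1
      _ = 2 * x / (1 - β) ^ 2 * lam * E n := by field_simp
  have hlim : Tendsto (fun n : ℕ => (n : ℝ) * E n ^ 2 + (E n + x) / (1 - β) ^ 2) atTop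
      (nhds (x / (1 - β) ^ 2)) := by
    simpa using hnE.add ((hE0.add_const x).div_const ((1 - β) ^ 2))
  refine hlim.congr' ?_
  filter_upwards [hbound, eventually_gt_atTop 0] with n hb hn
  have hn' : (n : ℝ) ≠ 0 := (Nat.cast_pos.2 hn).ne'
  have haE : a n = (E n + x) * (1 - β) := by simp only [hE]; field_simp; ring
  have hapos : 0 < a n := by
    rw [haE]
    exact mul_pos (by linarith [hb.1]) h1β
  rw [SMJ_sq_sub hβ0 hβ1 hn hapos, haE]
  field_simp
  ring
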